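/- arXiv:2206.04646 — 2 statements merged into one kernel-verified Lean document; each statement's English description precedes it below -/
import Mathlib

section
/- Assume K ≥ 2 and that the complexity function H is such that R^go < ∞. Then the limit R^go_∞ := lim_{B→∞} R^go_B exists (the sequence (R^go_B)_{B∈ℕ} converges to a finite real number). -/
open MeasureTheory Filter Set
open scoped ENNReal NNReal

noncomputable section

/-- KL divergence between Bernoulli distributions with means `q` and `p`
(conventions: `0·log(0/x) = 0`, and the divergence is `∞` if `p ∈ {0,1}` and `q ≠ p`). -/
def klBer (q p : ℝ) : ℝ≥0∞ :=
  if (p = 0 ∧ q ≠ 0) ∨ (p = 1 ∧ q ≠ 1) then ⊤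
  else ENNReal.ofReal (q * Real.log (q / p) + (1 - q) * Real.log ((1 - q) / (1 - p)))

/-- The probability simplex `Δ_K`. -/
def probSimplex (K : ℕ) : Set (Fin K → ℝ) := {r | (∀ i, 0 ≤ r i) ∧ ∑ i, r i = 1}

/-- The set of best arms `I*(P) = {i : P i = max_j P j}`. -/
def bestArms {K : ℕ} (P : Fin K → ℝ) : Set (Fin K) := {i | ∀ j, P j ≤ P i}

/-- The rate `R^go`. -/
def Rgo (K : ℕ) (H : (Fin K → ℝ) → ℝ≥0∞) : ℝ≥0∞ :=
  ⨆ (r : (Fin K → ℝ) → Fin K → ℝ) (_ : ∀ Q, r Q ∈ probSimplex K)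
    (J : (Fin K → ℝ) → Fin K),
    ⨅ (Q : Fin K → ℝ) (_ : ∀ i, Q i ∈ Icc (0 : ℝ) 1)
      (P : Fin K → ℝ) (_ : ∀ i, P i ∈ Icc (0 : ℝ) 1)
      (_ : J Q ∉ bestArms P),
      H P * ∑ i, ENNReal.ofReal (r Q i) * klBer (Q i) (P i)

/-- The inner objective of the `R^go_B` optimization problem, for a fixed tuple of
allocation functions `rB` (where `rB b` is the allocation of batch `b+1` as a function of
the empirical means of the first `b+1` batches) and recommendation function `J`. -/
def batchObj (K B : ℕ) (H : (Fin K → ℝ) → ℝ≥0∞)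
    (rB : (b : ℕ) → (Fin (b + 1) → Fin K → ℝ) → Fin K → ℝ)
    (J : (Fin B → Fin K → ℝ) → Fin K) : ℝ≥0∞ :=
  ⨅ (Qs : Fin B → Fin K → ℝ) (_ : ∀ b i, Qs b i ∈ Icc (0 : ℝ) 1)
    (P : Fin K → ℝ) (_ : ∀ i, P i ∈ Icc (0 : ℝ) 1)
    (_ : J Qs ∉ bestArms P),
    (H P / B) * ∑ b : Fin B, ∑ i,
      ENNReal.ofReal (rB b.1 (fun j => Qs (Fin.castLE b.isLt j)) i) * klBer (Qs b i) (P i)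

/-- The rate `R^go_B` for `B` batches. -/
def RgoB (K B : ℕ) (H : (Fin K → ℝ) → ℝ≥0∞) : ℝ≥0∞ :=
  ⨆ (rB : (b : ℕ) → (Fin (b + 1) → Fin K → ℝ) → Fin K → ℝ)
    (_ : ∀ b Qs, rB b Qs ∈ probSimplex K)
    (J : (Fin B → Fin K → ℝ) → Fin K),
    batchObj K B H rB J

lemma klBer_of_pos_of_lt_one {q p : ℝ} (hp₀ : 0 < p) (hp₁ : p < 1) :
    klBer q p = ENNReal.ofReal
      (p * InformationTheory.klFun (q / p)
        + (1 - p) * InformationTheory.klFun ((1 - q) / (1 - p))) := by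
  have h₁ : (1 - p) ≠ 0 := by linarith
  rw [klBer, if_neg (by rintro (h | h) <;> linarith [h.1])]
  congr 1
  simp only [InformationTheory.klFun_apply]
  field_simp
  ring

lemma convexOn_klFun_bernoulli {p : ℝ} (hp₀ : 0 < p) (hp₁ : p < 1) :
    ConvexOn ℝ (Icc (0 : ℝ) 1) fun q =>
      p * InformationTheory.klFun (q / p)
        + (1 - p) * InformationTheory.klFun ((1 - q) / (1 - p)) := by
  have hp₁' : 0 < 1 - p := by linarith
  refine ⟨convex_Icc 0 1, fun x hx y hy a b ha hb hab => ?_⟩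
  have h₁ := InformationTheory.convexOn_klFun.2 (x := x / p) (y := y / p)
    (div_nonneg hx.1 hp₀.le) (div_nonneg hy.1 hp₀.le) ha hb hab
  have h₂ := InformationTheory.convexOn_klFun.2 (x := (1 - x) / (1 - p)) (y := (1 - y) / (1 - p))
    (div_nonneg (by linarith [hx.2]) hp₁'.le) (div_nonneg (by linarith [hy.2]) hp₁'.le) ha hb hab
  simp only [smul_eq_mul] at h₁ h₂ ⊢
  have e₁ : a * (x / p) + b * (y / p) = (a * x + b * y) / p := by ring
  have e₂ : a * ((1 - x) / (1 - p)) + b * ((1 - y) / (1 - p))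
      = (1 - (a * x + b * y)) / (1 - p) := by
    obtain rfl : b = 1 - a := by linarith
    ring
  rw [e₁] at h₁
  rw [e₂] at h₂
  nlinarith [mul_le_mul_of_nonneg_left h₁ hp₀.le, mul_le_mul_of_nonneg_left h₂ hp₁'.le]

/-- Jensen's inequality for the Bernoulli divergence in its first argument. -/
lemma klBer_sum_le {ι : Type*} (s : Finset ι) (w q : ι → ℝ) {p : ℝ}
    (hw : ∀ k ∈ s, 0 ≤ w k) (hw₁ : ∑ k ∈ s, w k = 1) (hq : ∀ k ∈ s, q k ∈ Icc (0 : ℝ) 1)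
    (hp : p ∈ Icc (0 : ℝ) 1) :
    klBer (∑ k ∈ s, w k * q k) p ≤ ∑ k ∈ s, ENNReal.ofReal (w k) * klBer (q k) p := by
  have top_of_term (k : ι) (hk : k ∈ s) (hwk : w k ≠ 0) (h : klBer (q k) p = ⊤) :
      ∑ k ∈ s, ENNReal.ofReal (w k) * klBer (q k) p = ⊤ := by
    refine ENNReal.sum_eq_top.2 ⟨k, hk, ?_⟩
    rw [h, ENNReal.mul_top]
    simpa using lt_of_le_of_ne (hw k hk) hwk.symm
  rcases eq_or_lt_of_le hp.1 with rfl | hp₀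
  · by_cases h : ∑ k ∈ s, w k * q k = 0
    · simp [h, klBer]
    · obtain ⟨k, hk, hne⟩ := Finset.exists_ne_zero_of_sum_ne_zero h
      rw [top_of_term k hk (left_ne_zero_of_mul hne)
        (if_pos (Or.inl ⟨rfl, right_ne_zero_of_mul hne⟩))]
      exact le_top
  rcases eq_or_lt_of_le hp.2 with rfl | hp₁
  · by_cases h : ∑ k ∈ s, w k * q k = 1
    · simp [h, klBer]
    · have h' : ∑ k ∈ s, w k * (q k - 1) ≠ 0 := by
        simpa [mul_sub, Finset.sum_sub_distrib, hw₁, sub_eq_zero] using h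
      obtain ⟨k, hk, hne⟩ := Finset.exists_ne_zero_of_sum_ne_zero h'
      rw [top_of_term k hk (left_ne_zero_of_mul hne)
        (if_pos (Or.inr ⟨rfl, sub_ne_zero.1 (right_ne_zero_of_mul hne)⟩))]
      exact le_top
  simp only [klBer_of_pos_of_lt_one hp₀ hp₁]
  have hnn (k : ι) (hk : k ∈ s) : 0 ≤ p * InformationTheory.klFun (q k / p)
      + (1 - p) * InformationTheory.klFun ((1 - q k) / (1 - p)) := by
    have h₁ : 0 < 1 - p := by linarith
    have := InformationTheory.klFun_nonneg (div_nonneg (hq k hk).1 hp₀.le)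
    have := InformationTheory.klFun_nonneg
      (div_nonneg (sub_nonneg.2 (hq k hk).2) h₁.le)
    positivity
  have hJ := (convexOn_klFun_bernoulli hp₀ hp₁).map_sum_le hw hw₁ hq
  simp only [smul_eq_mul] at hJ
  refine (ENNReal.ofReal_le_ofReal hJ).trans ?_
  rw [ENNReal.ofReal_sum_of_nonneg fun k hk => mul_nonneg (hw k hk) (hnn k hk)]
  exact Finset.sum_le_sum fun k hk => (ENNReal.ofReal_mul (hw k hk)).le

lemma klBer_convexComb_le {t x y p : ℝ} (ht : t ∈ Icc (0 : ℝ) 1) (hx : x ∈ Icc (0 : ℝ) 1)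
    (hy : y ∈ Icc (0 : ℝ) 1) (hp : p ∈ Icc (0 : ℝ) 1) :
    klBer ((1 - t) * x + t * y) p
      ≤ ENNReal.ofReal (1 - t) * klBer x p + ENNReal.ofReal t * klBer y p := by
  simpa [Fin.sum_univ_two] using klBer_sum_le Finset.univ ![1 - t, t] ![x, y] (p := p)
    (by simp [Fin.forall_fin_two, ht.1, ht.2]) (by simp [Fin.sum_univ_two])
    (fun k _ => by fin_cases k <;> assumption) hp

lemma le_one_of_mem_probSimplex {K : ℕ} {r : Fin K → ℝ} (hr : r ∈ probSimplex K) (i : Fin K) :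
    r i ≤ 1 :=
  hr.2 ▸ Finset.single_le_sum (fun j _ => hr.1 j) (Finset.mem_univ i)

/-- The divergence collected from a batch with allocation `r` and empirical means `q`. -/
def batchCost {K : ℕ} (P r q : Fin K → ℝ) : ℝ≥0∞ :=
  ∑ i, ENNReal.ofReal (r i) * klBer (q i) (P i)

/-- Some strategy for `m` batches guarantees a total (unnormalised) divergence of at least `c`,
where the allocation of batch `b` may depend on the empirical means of the batches before `b + e`.
With `e = 1` this is the game defining `RgoB`; with `e = 0` the allocation is committed before
the empirical means of the batch are revealed. -/
def Guarantees (K : ℕ) (H : (Fin K → ℝ) → ℝ≥0∞) (e m : ℕ) (c : ℝ≥0∞) : Prop :=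
  ∃ (s : (ℕ → Fin K → ℝ) → ℕ → Fin K → ℝ) (J : (ℕ → Fin K → ℝ) → Fin K),
    (∀ Q b, s Q b ∈ probSimplex K) ∧
    (∀ b Q Q', (∀ j < b + e, Q j = Q' j) → s Q b = s Q' b) ∧
    (∀ Q Q', (∀ j < m, Q j = Q' j) → J Q = J Q') ∧
    ∀ Q : ℕ → Fin K → ℝ, (∀ b i, Q b i ∈ Icc (0 : ℝ) 1) →
      ∀ P : Fin K → ℝ, (∀ i, P i ∈ Icc (0 : ℝ) 1) → J Q ∉ bestArms P →
        c ≤ H P * ∑ b ∈ Finset.range m, batchCost P (s Q b) (Q b)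

lemma guarantees_of_lt_RgoB {K B : ℕ} {H : (Fin K → ℝ) → ℝ≥0∞} (hB : 0 < B) {c : ℝ≥0∞}
    (hc : c < RgoB K B H) : Guarantees K H 1 B (c * B) := by
  simp only [RgoB, lt_iSup_iff] at hc
  obtain ⟨rB, hrB, J, hc⟩ := hc
  refine ⟨fun Q b => rB b fun j => Q j, fun Q => J fun j => Q j, fun Q b => hrB _ _,
    fun b Q Q' h => ?_, fun Q Q' h => ?_, fun Q hQ P hP hJ => ?_⟩
  · exact congrArg (rB b) (funext fun j => h j j.isLt)
  · exact congrArg J (funext fun j => h j j.isLt)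
  · have h : c ≤ _ := hc.le.trans (iInf_le_of_le (fun j : Fin B => Q j)
      (iInf_le_of_le (fun b i => hQ b i) (iInf_le_of_le P (iInf_le_of_le hP (iInf_le _ hJ)))))
    have hB₀ : (B : ℝ≥0∞) ≠ 0 := by exact_mod_cast hB.ne'
    rw [mul_comm (H P / B), ← mul_div_assoc, mul_comm _ (H P),
      ENNReal.le_div_iff_mul_le (Or.inl hB₀) (Or.inl (ENNReal.natCast_ne_top B))] at h
    rw [Finset.sum_range]
    exact h

lemma Guarantees.le_RgoB {K m : ℕ} {H : (Fin K → ℝ) → ℝ≥0∞} (hm : 0 < m) {c : ℝ≥0∞}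
    (h : Guarantees K H 1 m c) : c / m ≤ RgoB K m H := by
  obtain ⟨s, J, hs, hs_adapted, hJ_adapted, hval⟩ := h
  let extend (n : ℕ) (Qs : Fin n → Fin K → ℝ) : ℕ → Fin K → ℝ :=
    fun j => if h : j < n then Qs ⟨j, h⟩ else 0
  have hm₀ : (m : ℝ≥0∞) ≠ 0 := by exact_mod_cast hm.ne'
  refine le_iSup₂_of_le (fun b Qs => s (extend (b + 1) Qs) b) (fun b Qs => hs _ _)
    (le_iSup_of_le (fun Qs => J (extend m Qs)) ?_)
  refine le_iInf fun Qs => le_iInf fun hQs => le_iInf fun P => le_iInf fun hP =>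
    le_iInf fun hJ => ?_
  have hext (b : ℕ) (i : Fin K) : extend m Qs b i ∈ Icc (0 : ℝ) 1 := by
    by_cases hb : b < m <;> simp only [extend, hb, dite_true, dite_false]
    · exact hQs _ _
    · simp
  rw [mul_comm (H P / m), ← mul_div_assoc, mul_comm _ (H P)]
  refine ENNReal.div_le_div_right ((hval _ hext P hP hJ).trans_eq ?_) _
  rw [Finset.sum_range]
  congr 1
  refine Finset.sum_congr rfl fun b _ => ?_
  have h₁ : s (extend m Qs) b
      = s (extend (b + 1) fun j => Qs (Fin.castLE b.isLt j)) b := by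
    refine hs_adapted _ _ _ fun j hj => ?_
    simp [extend, hj, show j < m by omega]
  have h₂ : extend m Qs b = Qs b := by simp [extend]
  rw [h₁, h₂, batchCost]

lemma Guarantees.mono {K m m' : ℕ} {H : (Fin K → ℝ) → ℝ≥0∞} {c : ℝ≥0∞}
    (h : Guarantees K H 0 m c) (hmm : m ≤ m') : Guarantees K H 1 m' c := by
  obtain ⟨s, J, hs, hs_adapted, hJ_adapted, hval⟩ := h
  refine ⟨s, J, hs, fun b Q Q' h => hs_adapted b Q Q' fun j hj => h j (by omega),
    fun Q Q' h => hJ_adapted Q Q' fun j hj => h j (by omega), fun Q hQ P hP hJ => ?_⟩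
  refine (hval Q hQ P hP hJ).trans ?_
  gcongr

lemma sum_range_mul_eq_sum_sum {M : Type*} [AddCommMonoid M] (f : ℕ → M) (n m : ℕ) :
    ∑ b ∈ Finset.range (m * n), f b
      = ∑ j ∈ Finset.range m, ∑ k ∈ Finset.range n, f (j * n + k) := by
  induction m with
  | zero => simp
  | succ m ih => rw [Nat.succ_mul, Finset.sum_range_add, ih, Finset.sum_range_succ]

/-- When allocations are committed in advance, each batch may be split into `n` batches with the
same allocation: by convexity this multiplies the guaranteed divergence by `n`. -/
lemma Guarantees.nsmul {K m n : ℕ} {H : (Fin K → ℝ) → ℝ≥0∞} {c : ℝ≥0∞} (hn : 0 < n)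
    (h : Guarantees K H 0 m c) : Guarantees K H 0 (m * n) (n * c) := by
  obtain ⟨s, J, hs, hs_adapted, hJ_adapted, hval⟩ := h
  let avg (Q : ℕ → Fin K → ℝ) : ℕ → Fin K → ℝ :=
    fun j i => ∑ k ∈ Finset.range n, (n : ℝ)⁻¹ * Q (j * n + k) i
  have hn₀ : (n : ℝ) ≠ 0 := by exact_mod_cast hn.ne'
  have hw : ∑ _k ∈ Finset.range n, (n : ℝ)⁻¹ = 1 := by simp [hn₀]
  have avg_congr (Q Q' : ℕ → Fin K → ℝ) (l : ℕ) (hQ : ∀ j < l * n, Q j = Q' j) (j : ℕ)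
      (hj : j < l) : avg Q j = avg Q' j := by
    refine funext fun i => Finset.sum_congr rfl fun k hk => ?_
    rw [hQ]
    have := Finset.mem_range.1 hk
    nlinarith
  refine ⟨fun Q b => s (avg Q) (b / n), fun Q => J (avg Q), fun Q b => hs _ _,
    fun b Q Q' h => hs_adapted _ _ _ (avg_congr Q Q' _ fun j hj => h j ?_),
    fun Q Q' h => hJ_adapted _ _ (avg_congr Q Q' m h), fun Q hQ P hP hJ => ?_⟩
  · exact hj.trans_le (Nat.div_mul_le_self b n)
  have havg (j : ℕ) (i : Fin K) : avg Q j i ∈ Icc (0 : ℝ) 1 :=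
    (convex_Icc (0 : ℝ) 1).sum_mem (fun k _ => by positivity) hw fun k _ => hQ _ i
  have hbound (j : ℕ) : n * batchCost P (s (avg Q) j) (avg Q j)
      ≤ ∑ k ∈ Finset.range n, batchCost P (s (avg Q) ((j * n + k) / n)) (Q (j * n + k)) := by
    have hdiv : ∀ k ∈ Finset.range n, batchCost P (s (avg Q) ((j * n + k) / n)) (Q (j * n + k))
        = batchCost P (s (avg Q) j) (Q (j * n + k)) := fun k hk => by
      rw [mul_comm j n, Nat.mul_add_div hn, Nat.div_eq_of_lt (Finset.mem_range.1 hk), add_zero]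
    rw [Finset.sum_congr rfl hdiv]
    simp only [batchCost]
    rw [Finset.sum_comm, Finset.mul_sum]
    refine Finset.sum_le_sum fun i _ => ?_
    rw [← Finset.mul_sum, mul_left_comm]
    gcongr
    have hJensen := klBer_sum_le (Finset.range n) (fun _ => (n : ℝ)⁻¹)
      (fun k => Q (j * n + k) i) (fun _ _ => by positivity) hw (fun k _ => hQ _ i) (hP i)
    calc (n : ℝ≥0∞) * klBer (avg Q j i) (P i)
        ≤ n * ∑ k ∈ Finset.range n, ENNReal.ofReal (n : ℝ)⁻¹ * klBer (Q (j * n + k) i) (P i) := by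
          gcongr
      _ = ∑ k ∈ Finset.range n, klBer (Q (j * n + k) i) (P i) := by
          rw [← Finset.mul_sum, ← mul_assoc, ENNReal.ofReal_inv_of_pos (by positivity),
            ENNReal.ofReal_natCast, ENNReal.mul_inv_cancel (by exact_mod_cast hn.ne')
              (ENNReal.natCast_ne_top n), one_mul]
  calc (n : ℝ≥0∞) * c
      ≤ n * (H P * ∑ j ∈ Finset.range m, batchCost P (s (avg Q) j) (avg Q j)) := by
        gcongr
        exact hval (avg Q) havg P hP hJ
    _ = H P * ∑ j ∈ Finset.range m, n * batchCost P (s (avg Q) j) (avg Q j) := by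
        rw [mul_left_comm, Finset.mul_sum]
    _ ≤ H P * ∑ b ∈ Finset.range (m * n), batchCost P (s (avg Q) (b / n)) (Q b) := by
        rw [sum_range_mul_eq_sum_sum]
        gcongr with j
        exact hbound j

/-- Histories of virtual batches for delayed tracking. Each arm keeps a stock of one batch of
samples; virtual batch `t` consumes the proportion `s _ t i` of the stock of arm `i`, which is
then replenished from the actual batch `K + t`. Entry `j ≤ t` of `stockHistory s Q t` is the
vector of stock means seen by virtual batch `j`; the later entries repeat entry `t`. -/
def stockHistory {K : ℕ} (s : (ℕ → Fin K → ℝ) → ℕ → Fin K → ℝ) (Q : ℕ → Fin K → ℝ) :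
    ℕ → ℕ → Fin K → ℝ
  | 0 => fun _ i => Q i i
  | t + 1 => fun j i =>
      if j ≤ t then stockHistory s Q t j i
      else (1 - s (stockHistory s Q t) t i) * stockHistory s Q t t i
        + s (stockHistory s Q t) t i * Q (K + t) i

lemma stockHistory_congr {K : ℕ} (s : (ℕ → Fin K → ℝ) → ℕ → Fin K → ℝ) {Q Q' : ℕ → Fin K → ℝ}
    (t : ℕ) (h : ∀ j < K + t, Q j = Q' j) : stockHistory s Q t = stockHistory s Q' t := by
  induction t with
  | zero => exact funext fun _ => funext fun i => by simp [stockHistory, h i (by omega)]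
  | succ t ih =>
    simp only [stockHistory, ih fun j hj => h j (by omega), h (K + t) (by omega)]

lemma stockHistory_of_le {K : ℕ} (s : (ℕ → Fin K → ℝ) → ℕ → Fin K → ℝ) (Q : ℕ → Fin K → ℝ)
    {j t : ℕ} (hj : j ≤ t) : stockHistory s Q t j = stockHistory s Q j j := by
  induction t, hj using Nat.le_induction with
  | base => rfl
  | succ t ht ih => rw [← ih]; exact funext fun i => by simp [stockHistory, ht]

/-- Delayed tracking: at the price of `K` additional batches, allocations can be committed before
the empirical means of the batch are revealed. -/
lemma Guarantees.delay {K B : ℕ} {H : (Fin K → ℝ) → ℝ≥0∞} {c : ℝ≥0∞}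
    (h : Guarantees K H 1 B c) : Guarantees K H 0 (K + B) c := by
  obtain ⟨s, J, hs, hs_adapted, hJ_adapted, hval⟩ := h
  let V (Q : ℕ → Fin K → ℝ) : ℕ → Fin K → ℝ := fun t => stockHistory s Q t t
  have hsV (Q : ℕ → Fin K → ℝ) (t : ℕ) : s (stockHistory s Q t) t = s (V Q) t :=
    hs_adapted _ _ _ fun j hj => stockHistory_of_le s Q (by omega)
  have V_succ (Q : ℕ → Fin K → ℝ) (t : ℕ) (i : Fin K) :
      V Q (t + 1) i = (1 - s (V Q) t i) * V Q t i + s (V Q) t i * Q (K + t) i := by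
    simp [V, stockHistory, ← hsV Q t]
  refine ⟨fun Q b => if hb : b < K then Pi.single ⟨b, hb⟩ 1
      else s (stockHistory s Q (b - K)) (b - K),
    fun Q => J (V Q), fun Q b => ?_, fun b Q Q' h => ?_, fun Q Q' h => ?_,
    fun Q hQ P hP hJ => ?_⟩
  · by_cases hb : b < K
    · simp only [hb, dite_true]
      refine ⟨fun i => ?_, by simp⟩
      by_cases hi : i = ⟨b, hb⟩ <;> simp [hi]
    · simp only [hb, dite_false]
      exact hs _ _
  · by_cases hb : b < K
    · simp [hb]
    · simp only [hb, dite_false]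
      rw [stockHistory_congr s _ fun j hj => h j (by omega)]
  · exact hJ_adapted _ _ fun j hj => by
      simp only [V]
      rw [stockHistory_congr s _ fun l hl => h l (by omega)]
  have hV (t : ℕ) (i : Fin K) : V Q t i ∈ Icc (0 : ℝ) 1 := by
    induction t with
    | zero => exact hQ _ _
    | succ t ih =>
      rw [V_succ]
      exact convex_Icc (0 : ℝ) 1 ih (hQ _ i)
        (sub_nonneg.2 (le_one_of_mem_probSimplex (hs _ _) i)) ((hs _ _).1 i) (by ring)
  have invariant (T : ℕ) :
      ∑ t ∈ Finset.range T, batchCost P (s (V Q) t) (V Q t) + ∑ i, klBer (V Q T i) (P i)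
        ≤ ∑ i, klBer (V Q 0 i) (P i)
          + ∑ t ∈ Finset.range T, batchCost P (s (V Q) t) (Q (K + t)) := by
    induction T with
    | zero => simp
    | succ T ih =>
      rw [Finset.sum_range_succ, Finset.sum_range_succ, ← add_assoc]
      refine le_trans ?_ (add_le_add_left ih _)
      rw [add_assoc, add_assoc]
      refine add_le_add le_rfl ?_
      simp only [batchCost]
      rw [← Finset.sum_add_distrib, ← Finset.sum_add_distrib]
      refine Finset.sum_le_sum fun i _ => ?_
      have h₀ := (hs (V Q) T).1 i
      have h₁ := le_one_of_mem_probSimplex (hs (V Q) T) i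
      rw [V_succ]
      refine (add_le_add_right
        (klBer_convexComb_le ⟨h₀, h₁⟩ (hV T i) (hQ _ i) (hP i)) _).trans_eq ?_
      rw [← add_assoc, ← add_mul, ← ENNReal.ofReal_add h₀ (sub_nonneg.2 h₁)]
      simp
  refine (hval (V Q) hV P hP hJ).trans ?_
  gcongr
  refine (le_self_add.trans (invariant B)).trans_eq ?_
  rw [Finset.sum_range_add, Finset.sum_range (n := K)]
  congr 1
  · refine Finset.sum_congr rfl fun i _ => ?_
    simp [batchCost, V, stockHistory, Pi.single_apply, apply_ite ENNReal.ofReal]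
  · refine Finset.sum_congr rfl fun t _ => ?_
    simp [hsV]

lemma RgoB_le_Rgo {K B : ℕ} (hB : 0 < B) (H : (Fin K → ℝ) → ℝ≥0∞) :
    RgoB K B H ≤ Rgo K H := by
  have hB₀ : (B : ℝ) ≠ 0 := by exact_mod_cast hB.ne'
  refine iSup₂_le fun rB hrB => iSup_le fun J => ?_
  refine le_iSup₂_of_le
    (fun Q i => ∑ b : Fin B, (B : ℝ)⁻¹ * rB b (fun _ => Q) i) (fun Q => ⟨fun i => ?_, ?_⟩)
    (le_iSup_of_le (fun Q => J fun _ => Q) ?_)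
  · exact Finset.sum_nonneg fun b _ => mul_nonneg (by positivity) ((hrB _ _).1 i)
  · rw [Finset.sum_comm]
    simp [← Finset.mul_sum, (hrB _ _).2, hB₀]
  refine le_iInf fun Q => le_iInf fun hQ => le_iInf fun P => le_iInf fun hP =>
    le_iInf fun hJ => ?_
  refine le_trans (iInf_le_of_le (fun _ => Q) (iInf_le_of_le (fun _ i => hQ i)
    (iInf_le_of_le P (iInf_le_of_le hP (iInf_le _ hJ))))) (le_of_eq ?_)
  rw [div_eq_mul_inv, mul_assoc]
  congr 1
  rw [Finset.sum_comm, Finset.mul_sum]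
  refine Finset.sum_congr rfl fun i _ => ?_
  rw [← Finset.sum_mul, ← mul_assoc, ENNReal.ofReal_sum_of_nonneg fun b _ =>
    mul_nonneg (by positivity) ((hrB _ _).1 i), Finset.mul_sum]
  congr 1
  refine Finset.sum_congr rfl fun b _ => ?_
  rw [ENNReal.ofReal_mul (by positivity), ENNReal.ofReal_inv_of_pos (by positivity),
    ENNReal.ofReal_natCast]

lemma mul_div_le_RgoB {K B m : ℕ} {H : (Fin K → ℝ) → ℝ≥0∞} (hB : 0 < B) (hm : K + B ≤ m)
    {c : ℝ≥0∞} (hc : c < RgoB K B H) :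
    ((m / (K + B) : ℕ) : ℝ≥0∞) * (c * B) / m ≤ RgoB K m H :=
  (((guarantees_of_lt_RgoB hB hc).delay.nsmul (Nat.div_pos hm (by omega))).mono
    (Nat.mul_div_le m (K + B))).le_RgoB (by omega)

lemma eventually_le_RgoB {K B : ℕ} {H : (Fin K → ℝ) → ℝ≥0∞} (hB : 0 < B) {a c : ℝ≥0}
    (hac : a * (K + B) < c * B) (hc : c < RgoB K B H) :
    ∀ᶠ m : ℕ in atTop, a ≤ RgoB K m H := by
  have hac' : (a : ℝ) * (K + B) < c * B := by exact_mod_cast hac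
  obtain ⟨N, hN⟩ := exists_nat_gt ((c * B * (K + B) : ℝ) / (c * B - a * (K + B)))
  filter_upwards [eventually_ge_atTop N, eventually_ge_atTop (K + B)] with m hmN hm
  refine le_trans ?_ (mul_div_le_RgoB hB hm hc)
  have hm₀ : (m : ℝ≥0∞) ≠ 0 := by exact_mod_cast (by omega : m ≠ 0)
  rw [ENNReal.le_div_iff_mul_le (Or.inl hm₀) (Or.inl (ENNReal.natCast_ne_top m))]
  have hlarge : (c * B * (K + B) : ℝ) < m * (c * B - a * (K + B)) := by
    rw [div_lt_iff₀ (by linarith)] at hN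
    exact hN.trans_le (mul_le_mul_of_nonneg_right (by exact_mod_cast hmN) (by linarith))
  have hdiv : (m : ℝ) ≤ (K + B) * (m / (K + B) : ℕ) + (K + B) := by
    have := (Nat.lt_mul_div_succ m (show 0 < K + B by omega)).le
    rw [mul_add, mul_one] at this
    exact_mod_cast this
  have hpos : (0 : ℝ) < K + B := by exact_mod_cast (by omega : 0 < K + B)
  have hreal : (a : ℝ) * m ≤ (m / (K + B) : ℕ) * (c * B) := by
    refine le_of_mul_le_mul_right ?_ hpos
    nlinarith [mul_le_mul_of_nonneg_left hdiv (by positivity : (0 : ℝ) ≤ c * B)]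
  exact_mod_cast hreal

/-- Theorem 4 (existence of the limit `R^go_∞`): if `K ≥ 2` and `H` is such that
`R^go < ∞`, then the sequence `(R^go_B)_B` converges to a finite limit. -/
theorem RgoB_tendsto (K : ℕ) (hK : 2 ≤ K) (H : (Fin K → ℝ) → ℝ≥0∞)
    (hH : ∀ P : Fin K → ℝ, (∀ i, P i ∈ Icc (0 : ℝ) 1) → 0 < H P)
    (hfin : Rgo K H ≠ ⊤) :
    ∃ L : ℝ≥0∞, L ≠ ⊤ ∧ Tendsto (fun B : ℕ => RgoB K B H) atTop (nhds L) := by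
  have hle : limsup (fun B : ℕ => RgoB K B H) atTop ≤ Rgo K H :=
    limsup_le_of_le (h := (eventually_gt_atTop 0).mono fun B hB => RgoB_le_Rgo hB H)
  refine ⟨_, ne_top_of_le_ne_top hfin hle, tendsto_of_le_liminf_of_limsup_le ?_ le_rfl⟩
  refine le_of_forall_lt fun a ha => ?_
  obtain ⟨a', haa', ha'⟩ := ENNReal.lt_iff_exists_nnreal_btwn.1 ha
  obtain ⟨c, hac, hc⟩ := ENNReal.lt_iff_exists_nnreal_btwn.1 ha'
  have hac' : (a' : ℝ) < c := by exact_mod_cast hac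
  obtain ⟨N, hN⟩ := exists_nat_gt ((a' * K : ℝ) / (c - a'))
  obtain ⟨B, hB, hcB⟩ := ((frequently_lt_of_lt_limsup (h := hc)).and_eventually
    (eventually_ge_atTop (N + 1))).exists.imp fun _ h => h.symm
  refine haa'.trans_le (le_liminf_of_le (h := eventually_le_RgoB (by omega) ?_ hcB))
  have hBN : (N : ℝ) ≤ B := by exact_mod_cast (by omega : N ≤ B)
  have hreal : (a' : ℝ) * (K + B) < c * B := by
    rw [div_lt_iff₀ (by linarith)] at hN
    nlinarith [mul_le_mul_of_nonneg_right hBN (by linarith : (0 : ℝ) ≤ c - a')]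
  exact_mod_cast hreal

end
end

section
/- For every ε ∈ (0, 0.1), setting P = (0.4, 0.5, 0.5−ε), the uniform allocation satisfies G((1/3, 1/3, 1/3); P) ≥ ε²/6. -/
open MeasureTheory Filter Set
open scoped ENNReal NNReal

noncomputable section

/-- The set of alternative instances `Alt(P)`: instances `P' ∈ [0,1]³` having a best arm
that is not a best arm of `P`. -/
def altSet (P : Fin 3 → ℝ) : Set (Fin 3 → ℝ) :=
  {P' | (∀ i, P' i ∈ Icc (0 : ℝ) 1) ∧ ¬ bestArms P' ⊆ bestArms P}

/-- `G(r; P) = inf_{P' ∈ Alt(P)} Σ_i r_i·d(P_i, P'_i)`. -/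
def Gfun (r P : Fin 3 → ℝ) : ℝ≥0∞ :=
  ⨅ (P' : Fin 3 → ℝ) (_ : P' ∈ altSet P), ∑ i, ENNReal.ofReal (r i) * klBer (P i) (P' i)

/-- A Hellinger-type lower bound on the binary relative entropy. -/
lemma sq_sub_le_binary_relative_entropy {q p : ℝ} (hq : q ∈ Ioo (0 : ℝ) 1)
    (hp : p ∈ Ioo (0 : ℝ) 1) :
    (q - p) ^ 2 ≤ q * Real.log (q / p) + (1 - q) * Real.log ((1 - q) / (1 - p)) := by
  have key : ∀ {x y : ℝ}, 0 < x → 0 < y →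
      2 * x ^ 2 - 2 * (x * y) ≤ x ^ 2 * Real.log (x ^ 2 / y ^ 2) := by
    intro x y hx hy
    have h := Real.log_le_sub_one_of_pos (div_pos hy hx)
    rw [← div_pow, Real.log_pow, ← inv_div, Real.log_inv]
    have h' := mul_le_mul_of_nonneg_left h (sq_nonneg x)
    have e : x ^ 2 * (y / x - 1) = x * y - x ^ 2 := by field_simp
    push_cast
    linarith
  have hq' : 0 < 1 - q := sub_pos.2 hq.2
  have hp' : 0 < 1 - p := sub_pos.2 hp.2
  have h₁ := key (Real.sqrt_pos.2 hq.1) (Real.sqrt_pos.2 hp.1)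
  have h₂ := key (Real.sqrt_pos.2 hq') (Real.sqrt_pos.2 hp')
  have sq := Real.sq_sqrt hq.1.le
  have sp := Real.sq_sqrt hp.1.le
  have sq' := Real.sq_sqrt hq'.le
  have sp' := Real.sq_sqrt hp'.le
  rw [sq, sp] at h₁
  rw [sq', sp'] at h₂
  set t := √q
  set s := √p
  set t' := √(1 - q)
  set s' := √(1 - p)
  have ht : t ^ 2 + t' ^ 2 = 1 := by rw [sq, sq']; ring
  have hs : s ^ 2 + s' ^ 2 = 1 := by rw [sp, sp']; ring
  have hdiff : q - p = (t * s' - t' * s) * (t * s' + t' * s) := by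
    linear_combination (-1) * sq + sp - t ^ 2 * hs + s ^ 2 * ht
  have hsin : (t * s' - t' * s) ^ 2 = 1 - (t * s + t' * s') ^ 2 := by
    linear_combination (s ^ 2 + s' ^ 2) * ht + hs
  have hsum : (t * s' + t' * s) ^ 2 ≤ 1 := by
    have : (t * s' + t' * s) ^ 2 = 1 - (t * s - t' * s') ^ 2 := by
      linear_combination (s ^ 2 + s' ^ 2) * ht + hs
    linarith [sq_nonneg (t * s - t' * s')]
  have hle : (q - p) ^ 2 ≤ 1 - (t * s + t' * s') ^ 2 := by
    rw [hdiff, mul_pow, ← hsin]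
    exact mul_le_of_le_one_right (sq_nonneg _) hsum
  linarith [sq_nonneg (1 - (t * s + t' * s'))]

lemma ofReal_sq_sub_le_klBer {q p : ℝ} (hq : q ∈ Ioo (0 : ℝ) 1) (hp : p ∈ Icc (0 : ℝ) 1) :
    ENNReal.ofReal ((q - p) ^ 2) ≤ klBer q p := by
  unfold klBer
  split_ifs with h
  · exact le_top
  · have h0 : p ≠ 0 := fun h0 => h (Or.inl ⟨h0, hq.1.ne'⟩)
    have h1 : p ≠ 1 := fun h1 => h (Or.inr ⟨h1, hq.2.ne⟩)
    exact ENNReal.ofReal_le_ofReal (sq_sub_le_binary_relative_entropy hq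
      ⟨lt_of_le_of_ne hp.1 h0.symm, lt_of_le_of_ne hp.2 h1⟩)

/-- For the instance `P = (0.4, 0.5, 0.5−ε)` with `ε ∈ (0, 0.1)`, the uniform allocation
satisfies `G((1/3,1/3,1/3); P) ≥ ε²/6`. -/
theorem fc_uniform_lb_two (ε : ℝ) (hε : ε ∈ Ioo (0 : ℝ) 0.1) :
    ENNReal.ofReal (ε ^ 2 / 6) ≤
      Gfun ![1 / 3, 1 / 3, 1 / 3] ![0.4, 0.5, 0.5 - ε] := by
  obtain ⟨h0, h1⟩ := hε
  refine le_iInf₂ fun P' hP' => ?_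
  obtain ⟨hmem, hbest⟩ := hP'
  obtain ⟨i, hi, hi'⟩ := Set.not_subset.1 hbest
  have hP : ∀ j, (![0.4, 0.5, 0.5 - ε] : Fin 3 → ℝ) j ∈ Ioo (0 : ℝ) 1 := by
    intro j
    fin_cases j <;> constructor <;> norm_num at h1 ⊢ <;> linarith
  have hr : ∀ j, (![1 / 3, 1 / 3, 1 / 3] : Fin 3 → ℝ) j = 1 / 3 := by
    intro j
    fin_cases j <;> rfl
  calc ENNReal.ofReal (ε ^ 2 / 6)
      ≤ ENNReal.ofReal (∑ j, 1 / 3 * ((![0.4, 0.5, 0.5 - ε] : Fin 3 → ℝ) j - P' j) ^ 2) := by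
        apply ENNReal.ofReal_le_ofReal
        have hi₁ := hi 1
        simp only [Fin.sum_univ_three, Matrix.cons_val]
        norm_num at h1 ⊢
        fin_cases i
        · change P' 1 ≤ P' 0 at hi₁
          nlinarith [sq_nonneg (2 / 5 - P' 0 + (1 / 2 - P' 1)), sq_nonneg (1 / 2 - ε - P' 2)]
        · refine absurd (fun j => ?_) hi'
          fin_cases j <;> norm_num <;> linarith
        · change P' 1 ≤ P' 2 at hi₁
          nlinarith [sq_nonneg (1 / 2 - ε - P' 2 + (1 / 2 - P' 1)), sq_nonneg (2 / 5 - P' 0)]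
    _ = ∑ j, ENNReal.ofReal (1 / 3) *
          ENNReal.ofReal (((![0.4, 0.5, 0.5 - ε] : Fin 3 → ℝ) j - P' j) ^ 2) := by
        rw [ENNReal.ofReal_sum_of_nonneg fun j _ => by positivity]
        exact Finset.sum_congr rfl fun j _ => ENNReal.ofReal_mul (by norm_num)
    _ ≤ _ := by
        refine Finset.sum_le_sum fun j _ => ?_
        rw [hr j]
        gcongr
        exact ofReal_sq_sub_le_klBer (hP j) (hmem j)

end
end
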